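/- arXiv:1910.04320 — 5 statements merged into one kernel-verified Lean document; each statement's English description precedes it below -/
import Mathlib

section
/- For each n, let k(n) ≥ 2, distinct reals c_1,…,c_{k(n)}, a real c(n) ∈ (0,1], positive integers n_1 ≥ … ≥ n_{k(n)} summing to n, and the true color assignment y_n ∈ Ω_{n_1,…,n_{k(n)}} be given, with observation R_n = K(y_n) + σ_n W_n. Assume: (i) n_i ≥ c(n)·n for every i and every n; (ii) lim_{n→∞} c(n)/(k(n)·(n_k + n_{k−1})) = 0; (iii) lim_{n→∞} log k(n)/log n = 0; (iv) liminf_{n→∞} c(n)·n·min{ c(n)/k(n), min_{i,j: n_i≠n_j} |n_i−n_j|/n } / (n_{k−1}+n_k) ≥ α for a constant α > 0 (with the convention that the minimum over the empty set of pairs (i,j) with n_i ≠ n_j is +∞); (v) there is a constant δ > 0 with σ_n² < (1−δ)·(n_{k−1}+n_k)/(4 log n) for all n. Then the probability that every minimizer of ‖R_n − K(x)‖_F² over x ∈ Ω_{n_1,…,n_{k(n)}} is equivalent to y_n tends to 1 as n → ∞. -/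
open MeasureTheory ProbabilityTheory Filter Finset

/-- The law of an `n × n` random matrix whose `n²` entries are i.i.d. standard Gaussians. -/
noncomputable def gaussMatrix (n : ℕ) : Measure (Fin n → Fin n → ℝ) :=
  Measure.pi fun _ : Fin n => Measure.pi fun _ : Fin n => gaussianReal 0 1

/-- The squared Frobenius norm of a real `n × n` matrix. -/
noncomputable def frobSq {n : ℕ} (A : Fin n → Fin n → ℝ) : ℝ := ∑ i, ∑ j, A i j ^ 2

/-- The matrix `K(x)` with `K(x)_{ij} = 1` if `x(i) ≠ x(j)` and `0` otherwise. -/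
noncomputable def Kmat {n k : ℕ} (x : Fin n → Fin k) : Fin n → Fin n → ℝ :=
  fun i j => if x i = x j then 0 else 1

/-- The number of vertices to which `x` assigns color `i`. -/
def colorCard {n k : ℕ} (x : Fin n → Fin k) (i : Fin k) : ℕ :=
  (Finset.univ.filter fun v => x v = i).card

/-- Two color assignments are equivalent if they induce the same partition of the vertices. -/
def ColorEquiv {n k : ℕ} (x z : Fin n → Fin k) : Prop :=
  ∀ i j : Fin n, x i = x j ↔ z i = z j

lemma integrable_exp_pairing_gaussMatrix {n : ℕ} (A : Fin n → Fin n → ℝ) :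
    Integrable (fun W => Real.exp (∑ i, ∑ j, A i j * W i j)) (gaussMatrix n) := by
  simp_rw [Real.exp_sum]
  exact Integrable.fintype_prod fun i => Integrable.fintype_prod
    (f := fun j w => Real.exp (A i j * w)) fun j => integrable_exp_mul_gaussianReal (A i j)

lemma integral_exp_pairing_gaussMatrix {n : ℕ} (A : Fin n → Fin n → ℝ) :
    ∫ W, Real.exp (∑ i, ∑ j, A i j * W i j) ∂gaussMatrix n = Real.exp (frobSq A / 2) := by
  have hmgf (t : ℝ) : ∫ w, Real.exp (t * w) ∂gaussianReal 0 1 = Real.exp (t ^ 2 / 2) := by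
    simpa [mgf] using congrFun (mgf_id_gaussianReal (μ := 0) (v := 1)) t
  simp_rw [Real.exp_sum, gaussMatrix]
  rw [integral_fintype_prod_eq_prod
    (fun (i : Fin n) (w : Fin n → ℝ) => ∏ j, Real.exp (A i j * w j))]
  simp_rw [fun i => integral_fintype_prod_eq_prod (μ := fun _ : Fin n => gaussianReal 0 1)
    (fun (j : Fin n) (w : ℝ) => Real.exp (A i j * w)), hmgf, ← Real.exp_sum, frobSq, Finset.sum_div]

instance isProbabilityMeasure_gaussMatrix (n : ℕ) : IsProbabilityMeasure (gaussMatrix n) := by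
  unfold gaussMatrix; infer_instance

/-- Gaussian tail bound for the event that the noise moves the observation closer to a point at
displacement `A` than to the truth. -/
lemma gaussMatrix_halfspace_le {n : ℕ} (A : Fin n → Fin n → ℝ) {σ s : ℝ} (hA : 0 < frobSq A)
    (hs : σ ^ 2 ≤ s) :
    (gaussMatrix n).real {W | frobSq A + 2 * σ * ∑ i, ∑ j, A i j * W i j ≤ 0} ≤
      Real.exp (-(frobSq A / (8 * s))) := by
  rcases eq_or_ne σ 0 with rfl | hσ
  · have : {W : Fin n → Fin n → ℝ | frobSq A + 2 * 0 * ∑ i, ∑ j, A i j * W i j ≤ 0} = ∅ := by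
      ext W; simp [hA]
    rw [this, measureReal_empty]
    positivity
  have hσ2 : 0 < σ ^ 2 := by positivity
  have hpair (t : ℝ) (W : Fin n → Fin n → ℝ) :
      t * (2 * σ * ∑ i, ∑ j, A i j * W i j) = ∑ i, ∑ j, (t * (2 * σ) * A i j) * W i j := by
    simp_rw [Finset.mul_sum]
    exact Finset.sum_congr rfl fun i _ => Finset.sum_congr rfl fun j _ => by ring
  have hfrob (t : ℝ) : frobSq (fun i j => t * A i j) = t ^ 2 * frobSq A := by
    simp_rw [frobSq, Finset.mul_sum, mul_pow]
  have key := measure_le_le_exp_mul_mgf (μ := gaussMatrix n)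
    (X := fun W => 2 * σ * ∑ i, ∑ j, A i j * W i j) (t := -(1 / (4 * σ ^ 2))) (-frobSq A)
    (by rw [neg_nonpos]; positivity)
    (by simp_rw [hpair]; exact integrable_exp_pairing_gaussMatrix _)
  rw [mgf] at key
  simp_rw [hpair] at key
  rw [integral_exp_pairing_gaussMatrix, hfrob, ← Real.exp_add] at key
  have hset : {W : Fin n → Fin n → ℝ | frobSq A + 2 * σ * ∑ i, ∑ j, A i j * W i j ≤ 0} =
      {W | 2 * σ * ∑ i, ∑ j, A i j * W i j ≤ -frobSq A} := by
    ext W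
    rw [Set.mem_ofPred_eq, Set.mem_ofPred_eq]
    constructor <;> intro h <;> linarith
  rw [hset]
  refine key.trans (Real.exp_le_exp.mpr ?_)
  have h1 : - -(1 / (4 * σ ^ 2)) * -frobSq A + (-(1 / (4 * σ ^ 2)) * (2 * σ)) ^ 2 * frobSq A / 2
      = -(frobSq A / (8 * σ ^ 2)) := by
    field_simp
    ring
  rw [h1, neg_le_neg_iff]
  gcongr

lemma frobSq_Kmat_sub {n k : ℕ} (x y : Fin n → Fin k) :
    frobSq (fun i j => Kmat y i j - Kmat x i j) =
      ∑ u, ∑ v, if (x u = x v ↔ y u = y v) then (0 : ℝ) else 1 := by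
  unfold frobSq Kmat
  refine Finset.sum_congr rfl fun u _ => Finset.sum_congr rfl fun v _ => ?_
  by_cases h1 : x u = x v <;> by_cases h2 : y u = y v <;> simp [h1, h2]

lemma colorCard_eq_sum {n k : ℕ} (x : Fin n → Fin k) (i : Fin k) :
    (colorCard x i : ℝ) = ∑ v, if x v = i then (1 : ℝ) else 0 := by
  simp [colorCard, Finset.sum_boole]

lemma hammingDist_eq_sum {n k : ℕ} (x y : Fin n → Fin k) :
    (hammingDist x y : ℝ) = ∑ v, if x v ≠ y v then (1 : ℝ) else 0 := by
  rw [Finset.sum_boole, hammingDist]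

lemma frobSq_Kmat_sub_ge_of_hammingDist {n k : ℕ} (x y : Fin n → Fin k) {m : ℝ}
    (hm : ∀ i j, i ≠ j → m ≤ colorCard y i + colorCard y j) :
    2 * hammingDist x y * (m - hammingDist x y) ≤
      frobSq (fun i j => Kmat y i j - Kmat x i j) := by
  set g : Fin n → Fin n → ℝ := fun u v => if x u ≠ y u ∧ x v = y v then
    ((if y v = y u then 1 else 0) + (if y v = x u then 1 else 0)) else 0 with hg
  have hpt (u v : Fin n) : g u v + g v u ≤ if (x u = x v ↔ y u = y v) then (0 : ℝ) else 1 := by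
    simp only [hg]
    split_ifs <;> grind
  have hrow (u : Fin n) : (if x u ≠ y u then m - hammingDist x y else 0) ≤ ∑ v, g u v := by
    by_cases hu : x u = y u
    · simp [hg, hu]
    · have h1 : ∀ v, (if y v = y u then (1 : ℝ) else 0) + (if y v = x u then 1 else 0) -
          (if x v ≠ y v then 1 else 0) ≤ g u v := by
        intro v
        simp only [hg]
        split_ifs <;> grind
      have h2 := Finset.sum_le_sum fun v (_ : v ∈ Finset.univ) => h1 v
      rw [Finset.sum_sub_distrib, Finset.sum_add_distrib, ← colorCard_eq_sum, ← colorCard_eq_sum,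
        ← hammingDist_eq_sum] at h2
      rw [if_pos hu]
      linarith [hm _ _ (Ne.symm hu)]
  have hG : hammingDist x y * (m - hammingDist x y) ≤ ∑ u, ∑ v, g u v := by
    refine le_trans (le_of_eq ?_) (Finset.sum_le_sum fun u _ => hrow u)
    rw [hammingDist_eq_sum, Finset.sum_mul]
    simp
  have hD := Finset.sum_le_sum fun u (_ : u ∈ Finset.univ) =>
    Finset.sum_le_sum fun v (_ : v ∈ Finset.univ) => hpt u v
  rw [← frobSq_Kmat_sub] at hD
  simp_rw [Finset.sum_add_distrib] at hD
  rw [Finset.sum_comm (f := fun u v => g v u)] at hD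
  linarith

/-- Sending each color of `x` to its most frequent color in `y` makes few mistakes when `K(x)` is
close to `K(y)`. -/
lemma exists_relabel_hammingDist_le {n k : ℕ} (x y : Fin n → Fin k) {b : ℝ}
    (hb : ∀ i, b ≤ colorCard x i) :
    ∃ p : Fin k → Fin k, b * hammingDist (p ∘ x) y ≤
      frobSq (fun i j => Kmat y i j - Kmat x i j) := by
  have hmax : ∀ i : Fin k, ∃ p : Fin k, ∀ j,
      (∑ v, if x v = i ∧ y v = j then (1 : ℝ) else 0) ≤
        ∑ v, if x v = i ∧ y v = p then (1 : ℝ) else 0 := fun i => by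
    obtain ⟨p, -, hp⟩ := Finset.exists_max_image Finset.univ
      (fun j => ∑ v, if x v = i ∧ y v = j then (1 : ℝ) else 0) ⟨i, Finset.mem_univ i⟩
    exact ⟨p, fun j => hp j (Finset.mem_univ j)⟩
  choose p hp using hmax
  refine ⟨p, ?_⟩
  have hsplit (u : Fin n) (j : Fin k) : (∑ v, if x v = x u ∧ y v ≠ j then (1 : ℝ) else 0) =
      colorCard x (x u) - ∑ v, if x v = x u ∧ y v = j then (1 : ℝ) else 0 := by
    rw [colorCard_eq_sum, ← Finset.sum_sub_distrib]
    refine Finset.sum_congr rfl fun v _ => ?_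
    split_ifs <;> grind
  calc b * hammingDist (p ∘ x) y
      ≤ ∑ v, ∑ u, if x v = x u ∧ y v ≠ p (x u) then (1 : ℝ) else 0 := by
        rw [hammingDist_eq_sum, Finset.mul_sum]
        refine Finset.sum_le_sum fun v _ => ?_
        by_cases h : p (x v) = y v
        · simp only [Function.comp_apply, h, ne_eq, not_true_eq_false, if_false, mul_zero]
          positivity
        · simp only [Function.comp_apply, ne_eq, h, not_false_eq_true, if_true, mul_one]
          refine (hb (x v)).trans ?_
          rw [colorCard_eq_sum]
          refine Finset.sum_le_sum fun u _ => ?_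
          split_ifs <;> grind
    _ = ∑ u, ∑ v, if x v = x u ∧ y v ≠ p (x u) then (1 : ℝ) else 0 := Finset.sum_comm
    _ ≤ ∑ u, ∑ v, if x v = x u ∧ y v ≠ y u then (1 : ℝ) else 0 := by
        refine Finset.sum_le_sum fun u _ => ?_
        rw [hsplit, hsplit]
        linarith [hp (x u) (y u)]
    _ ≤ frobSq (fun i j => Kmat y i j - Kmat x i j) := by
        rw [frobSq_Kmat_sub]
        refine Finset.sum_le_sum fun u _ => Finset.sum_le_sum fun v _ => ?_
        split_ifs <;> grind

lemma surjective_of_hammingDist_lt {n k : ℕ} {x y : Fin n → Fin k} {p : Fin k → Fin k} {b : ℝ}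
    (hb : ∀ i, b ≤ colorCard y i) (h : hammingDist (p ∘ x) y < b) : Function.Surjective p := by
  intro j
  by_contra! hj
  refine absurd ((hb j).trans ?_) (not_le.mpr h)
  rw [colorCard_eq_sum, hammingDist_eq_sum]
  refine Finset.sum_le_sum fun v _ => ?_
  have := hj (x v)
  simp only [Function.comp_apply]
  split_ifs <;> grind

lemma Kmat_comp {n k : ℕ} (x : Fin n → Fin k) {p : Fin k → Fin k} (hp : Function.Injective p) :
    Kmat (p ∘ x) = Kmat x := by
  ext i j
  simp [Kmat, hp.eq_iff]

lemma sum_pow_hammingDist_le {n k : ℕ} (y : Fin n → Fin k) {q : ℝ} (hq : 0 ≤ q) :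
    ∑ x : Fin n → Fin k, q ^ hammingDist x y ≤ Real.exp (n * (k * q)) := by
  have hterm (x : Fin n → Fin k) :
      q ^ hammingDist x y = ∏ v, if x v = y v then (1 : ℝ) else q := by
    rw [hammingDist, ← Finset.prod_const, Finset.prod_filter]
    exact Finset.prod_congr rfl fun v _ => by split_ifs <;> simp_all
  have hfac (v : Fin n) : (∑ j : Fin k, if j = y v then (1 : ℝ) else q) ≤ Real.exp (k * q) := by
    calc (∑ j : Fin k, if j = y v then (1 : ℝ) else q)
        ≤ ∑ j : Fin k, ((if j = y v then (1 : ℝ) else 0) + q) :=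
          Finset.sum_le_sum fun j _ => by split_ifs <;> linarith
      _ = k * q + 1 := by simp [Finset.sum_add_distrib, add_comm]
      _ ≤ Real.exp (k * q) := Real.add_one_le_exp _
  simp_rw [hterm]
  rw [← Fintype.piFinset_univ, ← Finset.prod_univ_sum (fun _ : Fin n => (Finset.univ : Finset (Fin k)))
    (fun v j => if j = y v then (1 : ℝ) else q)]
  calc _ ≤ ∏ _v : Fin n, Real.exp (k * q) := Finset.prod_le_prod
        (fun v _ => Finset.sum_nonneg fun j _ => by split_ifs <;> simp [hq]) fun v _ => hfac v
    _ = _ := by rw [Finset.prod_const, Finset.card_univ, Fintype.card_fin, ← Real.exp_nat_mul]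

lemma frobSq_Kmat_sub_pos {n k : ℕ} {x y : Fin n → Fin k} (h : ¬ ColorEquiv x y) :
    0 < frobSq (fun i j => Kmat y i j - Kmat x i j) := by
  rw [frobSq_Kmat_sub]
  simp only [ColorEquiv, not_forall] at h
  obtain ⟨i, j, hij⟩ := h
  refine Finset.sum_pos' (fun u _ => Finset.sum_nonneg fun v _ => by split_ifs <;> simp)
    ⟨i, Finset.mem_univ i, Finset.sum_pos' (fun v _ => by split_ifs <;> simp)
      ⟨j, Finset.mem_univ j, by simp [hij]⟩⟩

lemma colorEquiv_iff_Kmat_eq {n k : ℕ} {x y : Fin n → Fin k} :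
    ColorEquiv x y ↔ Kmat x = Kmat y := by
  constructor
  · intro h
    ext i j
    simp [Kmat, h i j]
  · intro h i j
    have := congrFun (congrFun h i) j
    simp only [Kmat] at this
    split_ifs at this <;> simp_all

lemma frobSq_noise_expand {n : ℕ} (Y X W : Fin n → Fin n → ℝ) (σ : ℝ) :
    frobSq (fun i j => (Y i j + σ * W i j) - X i j) =
      frobSq (fun i j => (Y i j + σ * W i j) - Y i j) + (frobSq (fun i j => Y i j - X i j) +
        2 * σ * ∑ i, ∑ j, (Y i j - X i j) * W i j) := by
  simp_rw [frobSq, Finset.mul_sum, ← Finset.sum_add_distrib]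
  exact Finset.sum_congr rfl fun i _ => Finset.sum_congr rfl fun j _ => by ring

lemma gaussMatrix_halfspace_le_rpow_pow {n k : ℕ} (hn : 2 ≤ n) {x y : Fin n → Fin k} (hxy : x ≠ y)
    {σ δ m : ℝ} (hm0 : 0 < m) (hδ : 0 < δ) (hδ1 : δ < 1)
    (hm : ∀ i j, i ≠ j → m ≤ colorCard y i + colorCard y j)
    (hh : hammingDist x y ≤ δ / 4 * m) (hσ : σ ^ 2 ≤ (1 - δ) * m / (4 * Real.log n)) :
    (gaussMatrix n).real {W | frobSq (fun i j => Kmat y i j - Kmat x i j) +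
        2 * σ * ∑ i, ∑ j, (Kmat y i j - Kmat x i j) * W i j ≤ 0} ≤
      ((n : ℝ) ^ (-(1 + δ / 2))) ^ hammingDist x y := by
  have hlog : 0 < Real.log n := Real.log_pos (by exact_mod_cast hn)
  have hn0 : (0 : ℝ) < n := by positivity
  have hh0 : (0 : ℝ) < hammingDist x y := by exact_mod_cast hammingDist_pos.mpr hxy
  have hD := frobSq_Kmat_sub_ge_of_hammingDist x y hm
  set D := frobSq (fun i j => Kmat y i j - Kmat x i j) with hDdef
  set h : ℝ := ((hammingDist x y : ℕ) : ℝ)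
  have hgap : (1 + δ / 2) * ((1 - δ) * m) ≤ m - h := by nlinarith [mul_pos hδ hm0]
  have hs : 0 < (1 - δ) * m := mul_pos (by linarith) hm0
  have hDlow : 2 * h * ((1 + δ / 2) * ((1 - δ) * m)) ≤ D :=
    le_trans (mul_le_mul_of_nonneg_left hgap (by positivity)) hD
  have hDpos : 0 < D := lt_of_lt_of_le (by positivity) hDlow
  refine (gaussMatrix_halfspace_le _ hDpos hσ).trans ?_
  rw [← Real.rpow_natCast, ← Real.rpow_mul hn0.le, Real.rpow_def_of_pos hn0]
  refine Real.exp_le_exp.mpr ?_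
  rw [← hDdef]
  have h1 : D / (8 * ((1 - δ) * m / (4 * Real.log n))) =
      D * Real.log n / (2 * ((1 - δ) * m)) := by
    field_simp
    ring
  have h2 : Real.log n * ((1 + δ / 2) * h) ≤ D * Real.log n / (2 * ((1 - δ) * m)) := by
    rw [le_div_iff₀ (by positivity)]
    nlinarith [mul_le_mul_of_nonneg_right hDlow hlog.le]
  rw [h1]
  change _ ≤ Real.log n * (-(1 + δ / 2) * h)
  linarith

lemma gaussMatrix_halfspace_le_rpow_pow_of_far {n : ℕ} (hn : 2 ≤ n) (A : Fin n → Fin n → ℝ)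
    {σ δ m r : ℝ} (hm0 : 0 < m) (hmn : m ≤ 2 * n) (hδ : 0 < δ) (hδ1 : δ < 1) (hr : 0 < r)
    (hA : r * n ^ 2 ≤ frobSq A) (hσ : σ ^ 2 ≤ (1 - δ) * m / (4 * Real.log n)) :
    (gaussMatrix n).real {W | frobSq A + 2 * σ * ∑ i, ∑ j, A i j * W i j ≤ 0} ≤
      ((n : ℝ) ^ (-(r / 4))) ^ n := by
  have hlog : 0 < Real.log n := Real.log_pos (by exact_mod_cast hn)
  have hn0 : (0 : ℝ) < n := by positivity
  have hs : 0 < (1 - δ) * m := mul_pos (by linarith) hm0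
  have hs2 : (1 - δ) * m ≤ 2 * n := by nlinarith
  refine (gaussMatrix_halfspace_le _ (lt_of_lt_of_le (by positivity) hA) hσ).trans ?_
  rw [← Real.rpow_natCast, ← Real.rpow_mul hn0.le, Real.rpow_def_of_pos hn0]
  refine Real.exp_le_exp.mpr ?_
  have h1 : frobSq A / (8 * ((1 - δ) * m / (4 * Real.log n))) =
      frobSq A * Real.log n / (2 * ((1 - δ) * m)) := by
    field_simp
    ring
  have h2 : Real.log n * (r / 4 * n) ≤ frobSq A * Real.log n / (2 * ((1 - δ) * m)) := by
    rw [le_div_iff₀ (by positivity)]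
    calc Real.log n * (r / 4 * n) * (2 * ((1 - δ) * m))
        ≤ Real.log n * (r / 4 * n) * (2 * (2 * n)) := by gcongr
      _ = r * n ^ 2 * Real.log n := by ring
      _ ≤ _ := by gcongr
  rw [h1]
  linarith

/-- Some assignment with the same class sizes that is not equivalent to `y` fits the observation at
least as well as `y` does. -/
def recoveryFailure {n k : ℕ} (y : Fin n → Fin k) (nn : Fin k → ℕ) (σ : ℝ) :
    Set (Fin n → Fin n → ℝ) :=
  {W | ∃ x : Fin n → Fin k, (∀ i, colorCard x i = nn i) ∧ ¬ ColorEquiv x y ∧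
    frobSq (fun i j => (Kmat y i j + σ * W i j) - Kmat x i j) ≤
      frobSq (fun i j => (Kmat y i j + σ * W i j) - Kmat y i j)}

lemma gaussMatrix_recoveryFailure_le {n k : ℕ} (hn : 2 ≤ n) (y : Fin n → Fin k) (nn : Fin k → ℕ)
    (hy : ∀ i, colorCard y i = nn i) {σ a δ m : ℝ} (ha : 0 < a) (hδ : 0 < δ) (hδ1 : δ < 1)
    (hna : ∀ i, a * n ≤ nn i) (hm : ∀ i j, i ≠ j → m ≤ nn i + nn j) (hma : 2 * a * n ≤ m)
    (hmn : m ≤ 2 * n) (hak : a * k ≤ 1) (hσ : σ ^ 2 ≤ (1 - δ) * m / (4 * Real.log n)) :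
    (gaussMatrix n).real (recoveryFailure y nn σ) ≤
      (Real.exp ((n : ℝ) ^ (-(δ / 2)) / a) - 1) + ((n : ℝ) ^ (-(a ^ 2 * δ / 8)) / a) ^ n := by
  have hn0 : (0 : ℝ) < n := by positivity
  have hm0 : 0 < m := lt_of_lt_of_le (by positivity) hma
  have hka : (k : ℝ) ≤ 1 / a := by rw [le_div_iff₀ ha]; linarith
  have hnay : ∀ i, a * n ≤ colorCard y i := fun i => by rw [hy]; exact hna i
  have hmy : ∀ i j, i ≠ j → m ≤ colorCard y i + colorCard y j := fun i j h => by
    rw [hy, hy]; exact hm i j h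
  set D : (Fin n → Fin k) → ℝ := fun x => frobSq (fun i j => Kmat y i j - Kmat x i j) with hD
  set F : (Fin n → Fin k) → Set (Fin n → Fin n → ℝ) := fun x =>
    {W | D x + 2 * σ * ∑ i, ∑ j, (Kmat y i j - Kmat x i j) * W i j ≤ 0} with hF
  set near : Finset (Fin n → Fin k) :=
    Finset.univ.filter fun x => x ≠ y ∧ (hammingDist x y : ℝ) ≤ δ / 4 * m with hnear
  set far : Finset (Fin n → Fin k) :=
    Finset.univ.filter fun x => a ^ 2 * δ / 2 * n ^ 2 ≤ D x with hfar
  have hcover : recoveryFailure y nn σ ⊆ (⋃ x ∈ near, F x) ∪ ⋃ x ∈ far, F x := by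
    rintro W ⟨x, hx, hne, hW⟩
    have hWF : W ∈ F x := by
      rw [frobSq_noise_expand (Kmat y) (Kmat x) W σ] at hW
      change D x + _ ≤ 0
      simp only [hD]
      linarith
    by_cases hfarx : a ^ 2 * δ / 2 * n ^ 2 ≤ D x
    · exact Or.inr (Set.mem_biUnion (by simpa [hfar] using hfarx) hWF)
    · left
      push Not at hfarx
      obtain ⟨p, hp⟩ := exists_relabel_hammingDist_le x y (b := a * n) fun i => by
        rw [hx]; exact hna i
      have hlt : (hammingDist (p ∘ x) y : ℝ) < a * δ / 2 * n := by
        have h1 : a * n * hammingDist (p ∘ x) y < a * n * (a * δ / 2 * n) := by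
          refine hp.trans_lt (hfarx.trans_le (le_of_eq ?_))
          ring
        exact lt_of_mul_lt_mul_left h1 (by positivity)
      have hinj : Function.Injective p := Finite.injective_iff_surjective.mpr <|
        surjective_of_hammingDist_lt hnay (hlt.trans_le (by nlinarith [mul_pos ha hn0]))
      have hK := Kmat_comp x hinj
      have hmem : p ∘ x ∈ near := by
        simp only [hnear, Finset.mem_filter, Finset.mem_univ, true_and]
        refine ⟨fun h => hne (colorEquiv_iff_Kmat_eq.mpr ?_), hlt.le.trans (by nlinarith)⟩
        rw [← hK, h]
      refine Set.mem_biUnion hmem ?_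
      simp only [hF, hD, hK]
      exact hWF
  have hnear_le : ∑ x ∈ near, (gaussMatrix n).real (F x) ≤
      Real.exp ((n : ℝ) ^ (-(δ / 2)) / a) - 1 := by
    set q : ℝ := (n : ℝ) ^ (-(1 + δ / 2)) with hq
    have hq0 : 0 ≤ q := by positivity
    have h1 : ∑ x ∈ near, (gaussMatrix n).real (F x) ≤ ∑ x ∈ near, q ^ hammingDist x y := by
      refine Finset.sum_le_sum fun x hx => ?_
      simp only [hnear, Finset.mem_filter, Finset.mem_univ, true_and] at hx
      exact gaussMatrix_halfspace_le_rpow_pow hn hx.1 hm0 hδ hδ1 hmy hx.2 hσ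
    have h2 : ∑ x ∈ near, q ^ hammingDist x y ≤
        ∑ x ∈ Finset.univ.erase y, q ^ hammingDist x y :=
      Finset.sum_le_sum_of_subset_of_nonneg
        (fun x hx => by
          simp only [hnear, Finset.mem_filter, Finset.mem_univ, true_and] at hx
          simp [hx.1]) fun _ _ _ => by positivity
    have h3 := Finset.add_sum_erase Finset.univ (fun x => q ^ hammingDist x y) (Finset.mem_univ y)
    rw [hammingDist_self, pow_zero] at h3
    have h4 : (n : ℝ) * (k * q) ≤ (n : ℝ) ^ (-(δ / 2)) / a := by
      have : (n : ℝ) ^ (-(δ / 2)) = n * q := by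
        rw [hq, ← Real.rpow_one_add' hn0.le (by linarith)]
        congr 1
        ring
      calc (n : ℝ) * (k * q) = k * (n * q) := by ring
        _ ≤ 1 / a * (n * q) := by gcongr
        _ = _ := by rw [this]; ring
    linarith [sum_pow_hammingDist_le y hq0, Real.exp_le_exp.mpr h4]
  have hfar_le : ∑ x ∈ far, (gaussMatrix n).real (F x) ≤
      ((n : ℝ) ^ (-(a ^ 2 * δ / 8)) / a) ^ n := by
    calc ∑ x ∈ far, (gaussMatrix n).real (F x)
        ≤ ∑ _x ∈ far, ((n : ℝ) ^ (-(a ^ 2 * δ / 8))) ^ n := by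
          refine Finset.sum_le_sum fun x hx => ?_
          simp only [hfar, Finset.mem_filter, Finset.mem_univ, true_and] at hx
          have := gaussMatrix_halfspace_le_rpow_pow_of_far hn _ hm0 hmn hδ hδ1 (by positivity) hx hσ
          rwa [show a ^ 2 * δ / 2 / 4 = a ^ 2 * δ / 8 by ring] at this
      _ ≤ ∑ _x : Fin n → Fin k, ((n : ℝ) ^ (-(a ^ 2 * δ / 8))) ^ n :=
          Finset.sum_le_sum_of_subset_of_nonneg (Finset.subset_univ _) fun _ _ _ => by positivity
      _ = (k * (n : ℝ) ^ (-(a ^ 2 * δ / 8))) ^ n := by simp [mul_pow]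
      _ ≤ (1 / a * (n : ℝ) ^ (-(a ^ 2 * δ / 8))) ^ n := by gcongr
      _ = _ := by rw [one_div_mul_eq_div]
  calc (gaussMatrix n).real (recoveryFailure y nn σ)
      ≤ (gaussMatrix n).real ((⋃ x ∈ near, F x) ∪ ⋃ x ∈ far, F x) :=
        measureReal_mono hcover
    _ ≤ (gaussMatrix n).real (⋃ x ∈ near, F x) + (gaussMatrix n).real (⋃ x ∈ far, F x) :=
        measureReal_union_le _ _
    _ ≤ _ := add_le_add ((measureReal_biUnion_finset_le _ _).trans hnear_le)
        ((measureReal_biUnion_finset_le _ _).trans hfar_le)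

lemma eventually_le_of_lt_liminf {u : ℕ → ℝ} {b : ℝ} (hb : 0 ≤ b) (h : b < liminf u atTop) :
    ∀ᶠ n in atTop, b ≤ u n := by
  rw [Filter.liminf_eq] at h
  have hne : {a | ∀ᶠ n in atTop, a ≤ u n}.Nonempty := by
    by_contra! hempty
    rw [hempty, Real.sSup_empty] at h
    exact absurd h (not_lt.mpr hb)
  obtain ⟨a, ha, hba⟩ := exists_lt_of_lt_csSup hne h
  filter_upwards [ha] with n hn using hba.le.trans hn

lemma tendsto_recoveryFailure_bound {a δ : ℝ} (ha : 0 < a) (hδ : 0 < δ) :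
    Tendsto (fun n : ℕ => (Real.exp ((n : ℝ) ^ (-(δ / 2)) / a) - 1) +
      ((n : ℝ) ^ (-(a ^ 2 * δ / 8)) / a) ^ n) atTop (nhds 0) := by
  have hpow {r : ℝ} (hr : 0 < r) :
      Tendsto (fun n : ℕ => (n : ℝ) ^ (-r) / a) atTop (nhds 0) := by
    simpa using ((tendsto_rpow_neg_atTop hr).comp tendsto_natCast_atTop_atTop).div_const a
  have h1 := ((Real.continuous_exp.tendsto 0).comp (hpow (half_pos hδ))).sub_const 1
  have h2 := hpow (r := a ^ 2 * δ / 8) (by positivity)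
  have h3 : Tendsto (fun n : ℕ => ((n : ℝ) ^ (-(a ^ 2 * δ / 8)) / a) ^ n) atTop (nhds 0) := by
    refine tendsto_of_tendsto_of_tendsto_of_le_of_le' tendsto_const_nhds h2
      (Eventually.of_forall fun n => by positivity) ?_
    filter_upwards [h2.eventually_le_const one_pos, eventually_ge_atTop 1] with n hn1 hn
    exact pow_le_of_le_one (by positivity) hn1 (by omega)
  simpa using h1.add h3

theorem exact_recovery_K_fixed_sizes_subcritical
    (k : ℕ → ℕ) (hk : ∀ n : ℕ, 2 ≤ k n)
    (c : (n : ℕ) → Fin (k n) → ℝ) (hc : ∀ n : ℕ, Function.Injective (c n))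
    (cc : ℕ → ℝ) (hcc : ∀ n : ℕ, 0 < cc n ∧ cc n ≤ 1)
    (nn : (n : ℕ) → Fin (k n) → ℕ)
    (hmono : ∀ n : ℕ, ∀ i j : Fin (k n), i ≤ j → nn n j ≤ nn n i)
    (hpos : ∀ n : ℕ, k n ≤ n → ∀ i : Fin (k n), 0 < nn n i)
    (hsum : ∀ n : ℕ, k n ≤ n → ∑ i, nn n i = n)
    (y : (n : ℕ) → Fin n → Fin (k n))
    (hy : ∀ n : ℕ, k n ≤ n → ∀ i : Fin (k n), colorCard (y n) i = nn n i)
    (hfiber : ∀ n : ℕ, k n ≤ n → ∀ i : Fin (k n), cc n * n ≤ (nn n i : ℝ))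
    (hckl : Tendsto (fun n : ℕ => cc n /
        ((k n : ℝ) * ((nn n ⟨k n - 1, by have := hk n; omega⟩ : ℝ) +
          (nn n ⟨k n - 2, by have := hk n; omega⟩ : ℝ)))) atTop (nhds 0))
    (hklog : Tendsto (fun n : ℕ => Real.log (k n) / Real.log n) atTop (nhds 0))
    (α : ℝ) (hα : 0 < α)
    (hliminf : α ≤ Filter.liminf (fun n : ℕ =>
        cc n * n *
          sInf ({cc n / k n} ∪
            {r : ℝ | ∃ i j : Fin (k n), nn n i ≠ nn n j ∧
              r = |(nn n i : ℝ) - (nn n j : ℝ)| / n}) /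
          ((nn n ⟨k n - 2, by have := hk n; omega⟩ : ℝ) +
            (nn n ⟨k n - 1, by have := hk n; omega⟩ : ℝ))) atTop)
    (σ : ℕ → ℝ) (δ : ℝ) (hδ : 0 < δ)
    (hσ : ∀ n : ℕ, k n ≤ n →
      σ n ^ 2 < (1 - δ) *
          ((nn n ⟨k n - 2, by have := hk n; omega⟩ : ℝ) +
            (nn n ⟨k n - 1, by have := hk n; omega⟩ : ℝ)) /
        (4 * Real.log n)) :
    Tendsto (fun n : ℕ => gaussMatrix n
        {W | ∀ x : Fin n → Fin (k n),
          (∀ i : Fin (k n), colorCard x i = nn n i) →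
          (∀ z : Fin n → Fin (k n), (∀ i : Fin (k n), colorCard z i = nn n i) →
            frobSq (fun i j => (Kmat (y n) i j + σ n * W i j) - Kmat x i j) ≤
            frobSq (fun i j => (Kmat (y n) i j + σ n * W i j) - Kmat z i j)) →
          ColorEquiv x (y n)})
      atTop (nhds 1) := by
  have hkn : ∀ᶠ n : ℕ in atTop, k n ≤ n := by
    filter_upwards [hklog.eventually_le_const one_pos, eventually_ge_atTop 2] with n hn hn2
    rw [div_le_one (Real.log_pos (by exact_mod_cast hn2))] at hn
    have hk0 : 0 < k n := by have := hk n; omega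
    exact_mod_cast (Real.log_le_log_iff (by positivity) (by positivity)).mp hn
  have hlim := eventually_le_of_lt_liminf (half_pos hα).le
    (lt_of_lt_of_le (half_lt_self hα) hliminf)
  have hfail : ∀ᶠ n : ℕ in atTop,
      (gaussMatrix n).real (recoveryFailure (y n) (nn n) (σ n)) ≤
        (Real.exp ((n : ℝ) ^ (-(δ / 2)) / α) - 1) + ((n : ℝ) ^ (-(α ^ 2 * δ / 8)) / α) ^ n := by
    filter_upwards [hkn, hlim, eventually_ge_atTop 2] with n hkn hlim hn
    have hk2 := hk n
    have hσn := hσ n hkn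
    have hn0 : (0 : ℝ) < n := by positivity
    have hlog : 0 < Real.log n := Real.log_pos (by exact_mod_cast hn)
    have hk0 : (2 : ℝ) ≤ k n := by exact_mod_cast hk2
    obtain ⟨hcc0, hcc1⟩ := hcc n
    set p : Fin (k n) := ⟨k n - 2, by omega⟩ with hp
    set l : Fin (k n) := ⟨k n - 1, by omega⟩ with hl
    set m : ℝ := (nn n p : ℝ) + nn n l with hm
    have hm2 : 2 * (cc n * n) ≤ m := by linarith [hfiber n hkn p, hfiber n hkn l]
    have hm0 : 0 < m := lt_of_lt_of_le (by positivity) hm2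
    have hlow : α / 2 * m ≤ cc n * n * (cc n / k n) := by
      rw [le_div_iff₀ hm0] at hlim
      refine hlim.trans (mul_le_mul_of_nonneg_left (csInf_le ⟨0, ?_⟩ (Or.inl rfl)) (by positivity))
      rintro r (rfl | ⟨i, j, -, rfl⟩) <;> positivity
    have hαk : α * k n ≤ cc n := by
      have h1 : cc n * n * α ≤ cc n * n * (cc n / k n) := by nlinarith
      have h2 := le_of_mul_le_mul_left h1 (by positivity)
      rwa [le_div_iff₀ (by linarith)] at h2
    have hαc : α ≤ cc n := by nlinarith
    have hnle (i : Fin (k n)) : (nn n i : ℝ) ≤ n := by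
      have := Finset.single_le_sum (fun j _ => Nat.zero_le (nn n j)) (Finset.mem_univ i)
      rw [hsum n hkn] at this
      exact_mod_cast this
    have hδ1 : δ < 1 := by
      by_contra! h
      have : (1 - δ) * m / (4 * Real.log n) ≤ 0 :=
        div_nonpos_of_nonpos_of_nonneg (mul_nonpos_of_nonpos_of_nonneg (by linarith) hm0.le)
          (by positivity)
      linarith [sq_nonneg (σ n)]
    have hlt (i j : Fin (k n)) (hij : i < j) : m ≤ nn n i + nn n j := by
      have h1 : nn n p ≤ nn n i := hmono n i p (by
        have := j.isLt
        rw [Fin.lt_def] at hij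
        rw [Fin.le_def, hp]
        simp only
        omega)
      have h2 : nn n l ≤ nn n j := hmono n j l (by
        have := j.isLt
        rw [Fin.le_def, hl]
        simp only
        omega)
      rw [hm]
      exact_mod_cast Nat.add_le_add h1 h2
    refine gaussMatrix_recoveryFailure_le hn (y n) (nn n) (hy n hkn) (m := m) hα hδ hδ1
      (fun i => le_trans (by gcongr) (hfiber n hkn i)) (fun i j hij => ?_) ?_ ?_
      (by linarith) hσn.le
    · rcases lt_or_gt_of_ne hij with h | h
      · exact hlt i j h
      · linarith [hlt j i h]
    · nlinarith
    · linarith [hnle p, hnle l]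
  have hfail0 : Tendsto (fun n => (gaussMatrix n).real (recoveryFailure (y n) (nn n) (σ n)))
      atTop (nhds 0) :=
    tendsto_of_tendsto_of_tendsto_of_le_of_le' tendsto_const_nhds
      (tendsto_recoveryFailure_bound hα hδ) (Eventually.of_forall fun n => measureReal_nonneg) hfail
  have hlower : Tendsto (fun n => 1 - ENNReal.ofReal
      ((gaussMatrix n).real (recoveryFailure (y n) (nn n) (σ n)))) atTop (nhds 1) := by
    simpa using ENNReal.Tendsto.sub tendsto_const_nhds (ENNReal.tendsto_ofReal hfail0)
      (Or.inl ENNReal.one_ne_top)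
  refine tendsto_of_tendsto_of_tendsto_of_le_of_le' hlower tendsto_const_nhds ?_
    (Eventually.of_forall fun n => prob_le_one)
  filter_upwards [hkn] with n hkn
  rw [ofReal_measureReal, tsub_le_iff_right, ← measure_univ (μ := gaussMatrix n)]
  refine (measure_mono fun W _ => ?_).trans (measure_union_le _ _)
  by_cases hW : W ∈ recoveryFailure (y n) (nn n) (σ n)
  · exact Or.inr hW
  · refine Or.inl fun x hx hmin => ?_
    by_contra hne
    exact hW ⟨x, hx, hne, hmin (y n) (hy n hkn)⟩
end

section
/- Let x, y ∈ Ω_{n_1,…,n_k} with x ≠ y. Then there exist an integer l with 2 ≤ l ≤ k and distinct indices i_1,…,i_l ∈ {1,…,k} such that, setting i_{l+1} := i_1, one has t_{i_{s−1}, i_s}(x,y) > 0 for every s = 2,…,l+1 (i.e., (i_1,…,i_l) is an l-cycle for (x,y)). -/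
open Finset

/-- `tCount x z i j` is the number of vertices having color `i` under `x` and color `j`
under `z`. -/
def tCount {n k : ℕ} (x z : Fin n → Fin k) (i j : Fin k) : ℕ :=
  (Finset.univ.filter fun l => x l = i ∧ z l = j).card

/-- If a color class has the same size under `x` and under `y`, then a color gained at some
vertex is lost at another. -/
theorem exists_ne_of_colorCard_eq {n k : ℕ} {x y : Fin n → Fin k} {v : Fin n}
    (hcard : colorCard x (y v) = colorCard y (y v)) (hv : x v ≠ y v) :
    ∃ w, x w = y v ∧ y w ≠ y v := by
  by_contra! h
  have hsub : (univ.filter fun w => x w = y v) ⊆ univ.filter fun w => y w = y v := by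
    intro w hw
    simp only [mem_filter, mem_univ, true_and] at hw ⊢
    exact h w hw
  have heq := eq_of_subset_of_card_le hsub hcard.ge
  have hmem : v ∈ univ.filter fun w => x w = y v := by
    rw [heq]
    simp
  exact hv (by simpa using hmem)

/-- Every forward orbit of a self-map of a finite type reaches a periodic point. -/
theorem exists_iterate_mem_periodicPts {α : Type*} [Finite α] (g : α → α) (a : α) :
    ∃ m, g^[m] a ∈ Function.periodicPts g := by
  obtain ⟨m, m', hne, heq⟩ : ∃ m m', m < m' ∧ g^[m] a = g^[m'] a := by
    obtain ⟨p, q, heq, hne⟩ :=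
      Function.not_injective_iff.mp (not_injective_infinite_finite fun m => g^[m] a)
    rcases lt_or_gt_of_ne hne with h | h
    exacts [⟨p, q, h, heq⟩, ⟨q, p, h, heq.symm⟩]
  refine ⟨m, m' - m, Nat.sub_pos_of_lt hne, ?_⟩
  rw [Function.IsPeriodicPt, Function.IsFixedPt, ← Function.iterate_add_apply,
    Nat.sub_add_cancel hne.le, heq]

theorem exists_cycle
    (n k : ℕ) (hk : 2 ≤ k)
    (nn : Fin k → ℕ) (hpos : ∀ i : Fin k, 0 < nn i) (hsum : ∑ i, nn i = n)
    (x y : Fin n → Fin k)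
    (hx : ∀ i : Fin k, colorCard x i = nn i)
    (hy : ∀ i : Fin k, colorCard y i = nn i)
    (hxy : x ≠ y) :
    ∃ l : ℕ, 2 ≤ l ∧ l ≤ k ∧ ∃ f : ZMod l → Fin k, Function.Injective f ∧
      ∀ s : ZMod l, 0 < tCount x y (f s) (f (s + 1)) := by
  have hstep : ∀ i, ∃ j, (∃ w, x w = i ∧ y w ≠ i) → ∃ w, x w = i ∧ y w = j ∧ j ≠ i := by
    intro i
    by_cases h : ∃ w, x w = i ∧ y w ≠ i
    · obtain ⟨w, hw, hw'⟩ := h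
      exact ⟨y w, fun _ => ⟨w, hw, rfl, hw'⟩⟩
    · exact ⟨i, fun h' => absurd h' h⟩
  choose g hg using hstep
  obtain ⟨v, hv⟩ := Function.ne_iff.mp hxy
  have horbit : ∀ m, ∃ w, x w = g^[m] (x v) ∧ y w ≠ g^[m] (x v) := by
    intro m
    induction m with
    | zero => exact ⟨v, rfl, hv.symm⟩
    | succ m ih =>
      obtain ⟨w, hw, hw', hne⟩ := hg _ ih
      rw [Function.iterate_succ_apply', ← hw']
      refine exists_ne_of_colorCard_eq ((hx _).trans (hy _).symm) ?_
      rw [hw, hw']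
      exact hne.symm
  obtain ⟨m, hm⟩ := exists_iterate_mem_periodicPts g (x v)
  set b := g^[m] (x v) with hb
  have hedge : ∀ r, ∃ w, x w = g^[r] b ∧ y w = g^[r + 1] b ∧ g^[r + 1] b ≠ g^[r] b := by
    intro r
    rw [Function.iterate_succ_apply', hb, ← Function.iterate_add_apply]
    exact hg _ (horbit (r + m))
  have hlpos := Function.minimalPeriod_pos_of_mem_periodicPts hm
  have hl1 : Function.minimalPeriod g b ≠ 1 := by
    intro h
    obtain ⟨w, -, -, hne⟩ := hedge 0
    exact hne (Function.minimalPeriod_eq_one_iff_isFixedPt.mp h)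
  have : NeZero (Function.minimalPeriod g b) := ⟨hlpos.ne'⟩
  have hinj : Function.Injective
      fun s : ZMod (Function.minimalPeriod g b) => g^[s.val] b := fun s t hst =>
    ZMod.val_injective _ (Function.iterate_injOn_Iio_minimalPeriod s.val_lt t.val_lt hst)
  refine ⟨Function.minimalPeriod g b, by omega, ?_, fun s => g^[s.val] b, hinj, fun s => ?_⟩
  · simpa using Fintype.card_le_of_injective _ hinj
  · obtain ⟨w, hw, hw', -⟩ := hedge s.val
    refine card_pos.mpr ⟨w, ?_⟩
    have hval : g^[(s + 1).val] b = g^[s.val + 1] b := by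
      have hlt : 1 < Function.minimalPeriod g b := by omega
      have : Fact (1 < Function.minimalPeriod g b) := ⟨hlt⟩
      rw [ZMod.val_add, ZMod.val_one, Function.iterate_mod_minimalPeriod_eq]
    simp only [mem_filter, mem_univ, true_and]
    exact ⟨hw, hw'.trans hval.symm⟩
end

section
/- Let c > 0, let x, y be color assignments in Ω with |y^{-1}(c_i)| ≥ c·n for every i ∈ {1,…,k}, let C_0 = min_{1≤i<j≤k}(c_i−c_j)², and let 0 < ε ≤ c/5. Define Q(x,y) = Σ_{u,v,i,j ∈ {1,…,k}} t_{u,v}(x,y)·t_{i,j}(x,y)·(c_u − c_v − c_i + c_j)². If there exists i ∈ {1,…,k} with t_{i,i}(x,y) < |y^{-1}(c_i)| − n·ε, then Q(x,y) ≥ 4·C_0·ε²·n². -/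
open Finset

theorem sum_tCount {n k : ℕ} (x y : Fin n → Fin k) (j : Fin k) :
    ∑ i, (tCount x y i j : ℝ) = colorCard y j := by
  have h : colorCard y j = ∑ i, tCount x y i j := by
    unfold colorCard tCount
    rw [Finset.card_eq_sum_card_fiberwise (f := x) (t := Finset.univ) (by simp)]
    simp only [Finset.filter_filter, and_comm]
  exact_mod_cast h.symm

theorem sInf_sq_sub_le {k : ℕ} (c : Fin k → ℝ) {u v : Fin k} (huv : u ≠ v) :
    sInf {r : ℝ | ∃ i j : Fin k, i < j ∧ r = (c i - c j) ^ 2} ≤ (c u - c v) ^ 2 := by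
  refine csInf_le ⟨0, ?_⟩ ?_
  · rintro r ⟨i, j, -, rfl⟩
    positivity
  · rcases lt_or_gt_of_ne huv with h | h
    · exact ⟨u, v, h, rfl⟩
    · exact ⟨v, u, h, by ring⟩

theorem sInf_sq_sub_nonneg {k : ℕ} (c : Fin k → ℝ) :
    0 ≤ sInf {r : ℝ | ∃ i j : Fin k, i < j ∧ r = (c i - c j) ^ 2} := by
  refine Real.sInf_nonneg ?_
  rintro r ⟨i, j, -, rfl⟩
  positivity

/-- Whatever the color displacement `c u - c v` is, the displacements on the fiber of `y` over an
extremal color have the opposite sign, so that fiber contributes `(c u - c v) ^ 2` per vertex. -/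
theorem exists_colorCard_mul_sq_le {n k : ℕ} (c : Fin k → ℝ) (x y : Fin n → Fin k) (u v : Fin k) :
    ∃ m, (colorCard y m : ℝ) * (c u - c v) ^ 2 ≤
      ∑ i, ∑ j, (tCount x y i j : ℝ) * (c u - c v - c i + c j) ^ 2 := by
  have key : ∀ m, (∀ i, (c u - c v) ^ 2 ≤ (c u - c v - c i + c m) ^ 2) →
      (colorCard y m : ℝ) * (c u - c v) ^ 2 ≤
        ∑ i, ∑ j, (tCount x y i j : ℝ) * (c u - c v - c i + c j) ^ 2 := by
    intro m hm
    rw [← sum_tCount x y m, Finset.sum_mul]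
    refine Finset.sum_le_sum fun i _ => ?_
    calc (tCount x y i m : ℝ) * (c u - c v) ^ 2
        ≤ (tCount x y i m : ℝ) * (c u - c v - c i + c m) ^ 2 :=
            mul_le_mul_of_nonneg_left (hm i) (by positivity)
      _ ≤ _ := Finset.single_le_sum
          (f := fun j => (tCount x y i j : ℝ) * (c u - c v - c i + c j) ^ 2)
          (fun j _ => by positivity) (Finset.mem_univ m)
  have : Nonempty (Fin k) := ⟨u⟩
  rcases le_total (c v) (c u) with h | h
  · obtain ⟨m, hm⟩ := Finite.exists_max c
    exact ⟨m, key m fun i => pow_le_pow_left₀ (by linarith) (by linarith [hm i]) 2⟩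
  · obtain ⟨m, hm⟩ := Finite.exists_min c
    refine ⟨m, key m fun i => ?_⟩
    nlinarith [hm i, mul_nonneg (sub_nonneg.2 h) (sub_nonneg.2 (hm i))]

theorem Q_lower_bound
    (n k : ℕ) (hk : 2 ≤ k) (c : Fin k → ℝ) (hc : Function.Injective c)
    (C0 : ℝ)
    (hC0 : C0 = sInf {r : ℝ | ∃ i j : Fin k, i < j ∧ r = (c i - c j) ^ 2})
    (cl : ℝ) (hcl : 0 < cl)
    (x y : Fin n → Fin k)
    (hfiber : ∀ i : Fin k, cl * n ≤ (colorCard y i : ℝ))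
    (ε : ℝ) (hε : 0 < ε) (hε' : ε ≤ cl / 5)
    (hbad : ∃ i : Fin k, (tCount x y i i : ℝ) < (colorCard y i : ℝ) - n * ε) :
    4 * C0 * ε ^ 2 * (n : ℝ) ^ 2 ≤
      ∑ u, ∑ v, ∑ i, ∑ j,
        (tCount x y u v : ℝ) * (tCount x y i j : ℝ) * (c u - c v - c i + c j) ^ 2 := by
  obtain ⟨w, hw⟩ := hbad
  have hC0nn : 0 ≤ C0 := hC0 ▸ sInf_sq_sub_nonneg c
  have hS : ∀ u, u ≠ w → cl * n * C0 ≤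
      ∑ i, ∑ j, (tCount x y i j : ℝ) * (c u - c w - c i + c j) ^ 2 := by
    intro u hu
    obtain ⟨m, hm⟩ := exists_colorCard_mul_sq_le c x y u w
    have hle : C0 ≤ (c u - c w) ^ 2 := hC0 ▸ sInf_sq_sub_le c hu
    exact (mul_le_mul (hfiber m) hle hC0nn (by positivity)).trans hm
  have hsum : ∑ u ∈ univ.erase w, (tCount x y u w : ℝ) = colorCard y w - tCount x y w w := by
    rw [← sum_tCount x y w, ← Finset.add_sum_erase _ _ (Finset.mem_univ w)]
    ring
  calc 4 * C0 * ε ^ 2 * (n : ℝ) ^ 2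
      ≤ (n * ε) * (5 * ε * n * C0) := by
        nlinarith [mul_nonneg hC0nn (sq_nonneg (ε * n))]
    _ ≤ (colorCard y w - tCount x y w w) * (cl * n * C0) := by
        refine mul_le_mul (by linarith) ?_ (by positivity) (by nlinarith)
        gcongr
        linarith
    _ = ∑ u ∈ univ.erase w, (tCount x y u w : ℝ) * (cl * n * C0) := by
        rw [← hsum, Finset.sum_mul]
    _ ≤ ∑ u ∈ univ.erase w, (tCount x y u w : ℝ) *
          ∑ i, ∑ j, (tCount x y i j : ℝ) * (c u - c w - c i + c j) ^ 2 := by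
        gcongr with u hu
        exact hS u (Finset.ne_of_mem_erase hu)
    _ ≤ ∑ u, (tCount x y u w : ℝ) *
          ∑ i, ∑ j, (tCount x y i j : ℝ) * (c u - c w - c i + c j) ^ 2 :=
        Finset.sum_le_sum_of_subset_of_nonneg (Finset.erase_subset _ _)
          fun u _ _ => by positivity
    _ ≤ ∑ u, ∑ v, (tCount x y u v : ℝ) *
          ∑ i, ∑ j, (tCount x y i j : ℝ) * (c u - c v - c i + c j) ^ 2 :=
        Finset.sum_le_sum fun u _ => Finset.single_le_sum
          (f := fun v => (tCount x y u v : ℝ) *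
            ∑ i, ∑ j, (tCount x y i j : ℝ) * (c u - c v - c i + c j) ^ 2)
          (fun v _ => by positivity) (Finset.mem_univ w)
    _ = _ := by simp only [Finset.mul_sum, mul_assoc]
end

section
/- For any two color assignments x, y ∈ Ω, define L(x,y) = Σ_{i=1}^{k} |x^{-1}(c_i)|² + Σ_{j=1}^{k} |y^{-1}(c_j)|² − 2·Σ_{i,j=1}^{k} t_{i,j}(x,y)². Then L(x,y) ≥ 0, and L(x,y) = 0 if and only if x and y are equivalent, i.e., for all vertices i, j ∈ {1,…,n}: x(i) = x(j) if and only if y(i) = y(j). -/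
open Finset

/-- The sum of the squared fiber cardinalities of `f` counts the pairs identified by `f`. -/
theorem sum_card_fiber_sq {α β : Type*} [Fintype α] [Fintype β] [DecidableEq β] (f : α → β) :
    ∑ b, ((univ.filter fun a => f a = b).card : ℝ) ^ 2 =
      ∑ u, ∑ v, if f u = f v then (1 : ℝ) else 0 := by
  have h (b : β) : ((univ.filter fun a => f a = b).card : ℝ) ^ 2 =
      ∑ u, ∑ v, (if f u = b then (1 : ℝ) else 0) * (if f v = b then 1 else 0) := by
    rw [← sum_mul_sum, sum_boole, sq]
  simp_rw [h]
  rw [sum_comm]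
  refine sum_congr rfl fun u _ => ?_
  rw [sum_comm]
  refine sum_congr rfl fun v _ => ?_
  simp [eq_comm]

theorem sum_colorCard_sq {n k : ℕ} (x : Fin n → Fin k) :
    ∑ i, (colorCard x i : ℝ) ^ 2 = ∑ u, ∑ v, if x u = x v then (1 : ℝ) else 0 :=
  sum_card_fiber_sq x

theorem sum_tCount_sq {n k : ℕ} (x y : Fin n → Fin k) :
    ∑ i, ∑ j, (tCount x y i j : ℝ) ^ 2 =
      ∑ u, ∑ v, if x u = x v ∧ y u = y v then (1 : ℝ) else 0 := by
  have h := sum_card_fiber_sq fun l => (x l, y l)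
  rw [Fintype.sum_prod_type] at h
  simpa only [tCount, Prod.mk.injEq] using h

theorem colorCard_tCount_eq_sum_sq {n k : ℕ} (x y : Fin n → Fin k) :
    ∑ i, (colorCard x i : ℝ) ^ 2 + ∑ j, (colorCard y j : ℝ) ^ 2 -
        2 * ∑ i, ∑ j, (tCount x y i j : ℝ) ^ 2 =
      ∑ u, ∑ v, ((if x u = x v then (1 : ℝ) else 0) - if y u = y v then 1 else 0) ^ 2 := by
  simp_rw [sum_colorCard_sq, sum_tCount_sq, mul_sum, ← sum_add_distrib, ← sum_sub_distrib]
  refine sum_congr rfl fun u _ => sum_congr rfl fun v _ => ?_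
  by_cases hx : x u = x v <;> by_cases hy : y u = y v <;> norm_num [hx, hy]

theorem L_nonneg_eq_zero_iff_equiv
    (n k : ℕ) (hk : 2 ≤ k)
    (x y : Fin n → Fin k) :
    0 ≤ ∑ i, (colorCard x i : ℝ) ^ 2 + ∑ j, (colorCard y j : ℝ) ^ 2 -
        2 * ∑ i, ∑ j, (tCount x y i j : ℝ) ^ 2 ∧
    ((∑ i, (colorCard x i : ℝ) ^ 2 + ∑ j, (colorCard y j : ℝ) ^ 2 -
        2 * ∑ i, ∑ j, (tCount x y i j : ℝ) ^ 2 = 0) ↔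
      ∀ i j : Fin n, x i = x j ↔ y i = y j) := by
  rw [colorCard_tCount_eq_sum_sq]
  refine ⟨by positivity, ?_⟩
  rw [Fintype.sum_eq_zero_iff_of_nonneg fun u => by simp only [Pi.zero_apply]; positivity,
    funext_iff]
  refine forall_congr' fun u => ?_
  rw [Pi.zero_apply, Fintype.sum_eq_zero_iff_of_nonneg fun v => sq_nonneg _, funext_iff]
  refine forall_congr' fun v => ?_
  by_cases hx : x u = x v <;> by_cases hy : y u = y v <;> simp [hx, hy]
end

section
/- Let c > 0 and ε > 0, and let x, y be color assignments in Ω with |y^{-1}(c_i)| ≥ c·n for every i ∈ {1,…,k}. Define L(x,y) = Σ_{i=1}^{k} |x^{-1}(c_i)|² + Σ_{j=1}^{k} |y^{-1}(c_j)|² − 2·Σ_{i,j=1}^{k} t_{i,j}(x,y)². If there exists i ∈ {1,…,k} such that t_{j,i}(x,y) < |y^{-1}(c_i)| − n·ε for every j ∈ {1,…,k}, then L(x,y) ≥ c·ε·n²/k. -/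
open Finset

theorem sum_tCount_right {n k : ℕ} (x z : Fin n → Fin k) (i : Fin k) :
    ∑ j, (tCount x z i j : ℝ) = colorCard x i := by
  have h := Finset.card_eq_sum_card_fiberwise (f := z)
    (s := Finset.univ.filter fun v => x v = i) (t := Finset.univ) (fun _ _ => by simp)
  simp only [Finset.filter_filter] at h
  simp only [tCount, colorCard]
  exact_mod_cast h.symm

theorem tCount_comm {n k : ℕ} (x z : Fin n → Fin k) (i j : Fin k) :
    tCount x z i j = tCount z x j i := by
  simp only [tCount, and_comm]

theorem sum_tCount_left {n k : ℕ} (x z : Fin n → Fin k) (j : Fin k) :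
    ∑ i, (tCount x z i j : ℝ) = colorCard z j := by
  simp only [tCount_comm x z, sum_tCount_right]

/-- If nonnegative reals all stay at least `δ` below their sum `s`, then the sum of their squares
stays at least `δ * s` below `s ^ 2`. -/
theorem mul_le_sq_sub_sum_sq {ι : Type*} [Fintype ι] (f : ι → ℝ) (s δ : ℝ)
    (hf : ∀ i, 0 ≤ f i) (hs : ∑ i, f i = s) (hδ : ∀ i, f i ≤ s - δ) :
    δ * s ≤ s ^ 2 - ∑ i, f i ^ 2 := by
  have h : ∑ i, f i ^ 2 ≤ ∑ i, (s - δ) * f i :=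
    Finset.sum_le_sum fun i _ => by nlinarith [mul_le_mul_of_nonneg_right (hδ i) (hf i)]
  rw [← Finset.mul_sum, hs] at h
  linarith

theorem sum_sq_le_sq_of_sum_eq {ι : Type*} [Fintype ι] (f : ι → ℝ) (s : ℝ)
    (hf : ∀ i, 0 ≤ f i) (hs : ∑ i, f i = s) : ∑ i, f i ^ 2 ≤ s ^ 2 :=
  hs ▸ Finset.sum_sq_le_sq_sum_of_nonneg fun i _ => hf i

theorem L_lower_bound
    (n k : ℕ) (hk : 2 ≤ k)
    (cl : ℝ) (hcl : 0 < cl) (ε : ℝ) (hε : 0 < ε)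
    (x y : Fin n → Fin k)
    (hfiber : ∀ i : Fin k, cl * n ≤ (colorCard y i : ℝ))
    (hbad : ∃ i : Fin k, ∀ j : Fin k,
      (tCount x y j i : ℝ) < (colorCard y i : ℝ) - n * ε) :
    cl * ε * (n : ℝ) ^ 2 / k ≤
      ∑ i, (colorCard x i : ℝ) ^ 2 + ∑ j, (colorCard y j : ℝ) ^ 2 -
        2 * ∑ i, ∑ j, (tCount x y i j : ℝ) ^ 2 := by
  obtain ⟨i₀, hi₀⟩ := hbad
  have hrow : ∑ i, ∑ j, (tCount x y i j : ℝ) ^ 2 ≤ ∑ i, (colorCard x i : ℝ) ^ 2 :=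
    Finset.sum_le_sum fun i _ =>
      sum_sq_le_sq_of_sum_eq _ _ (fun _ => Nat.cast_nonneg _) (sum_tCount_right x y i)
  have hcol : ∀ j, 0 ≤ (colorCard y j : ℝ) ^ 2 - ∑ i, (tCount x y i j : ℝ) ^ 2 := fun j =>
    sub_nonneg.2 <|
      sum_sq_le_sq_of_sum_eq _ _ (fun _ => Nat.cast_nonneg _) (sum_tCount_left x y j)
  have hcol₀ : n * ε * colorCard y i₀ ≤
      (colorCard y i₀ : ℝ) ^ 2 - ∑ i, (tCount x y i i₀ : ℝ) ^ 2 :=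
    mul_le_sq_sub_sum_sq _ _ _ (fun _ => Nat.cast_nonneg _) (sum_tCount_left x y i₀)
      fun j => (hi₀ j).le
  have hsum := Finset.single_le_sum (fun j _ => hcol j) (Finset.mem_univ i₀)
  rw [Finset.sum_sub_distrib, Finset.sum_comm] at hsum
  have hn : n * ε * (cl * n) ≤ n * ε * colorCard y i₀ :=
    mul_le_mul_of_nonneg_left (hfiber i₀) (by positivity)
  have hdiv : cl * ε * (n : ℝ) ^ 2 / k ≤ cl * ε * (n : ℝ) ^ 2 :=
    div_le_self (by positivity) (by exact_mod_cast (by omega : 1 ≤ k))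
  linarith
end
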